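/- arXiv:2410.03148 — 2 statements merged into one kernel-verified Lean document; each statement's English description precedes it below -/
import Mathlib

section
/- Let C be a real symmetric positive definite matrix indexed by pairs (i,j) ∈ Fin 3 × Fin 3, and let h be the vector with h_(i,j) = 1 if i = j and h_(i,j) = 0 otherwise. Then (hᵀ C⁻¹ h)⁻¹ = (1/9)·(hᵀ C h) if and only if h is an eigenvector of C, i.e. there exists μ ∈ ℝ with C·h = μ·h (in particular, equality holds for isotropic materials). -/
open Matrix

/-- Equality case of the Cauchy-Schwarz inequality
`(x ⬝ᵥ x) ^ 2 ≤ (x ⬝ᵥ A *ᵥ x) * (x ⬝ᵥ A⁻¹ *ᵥ x)` for a positive definite matrix `A`. -/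
theorem Matrix.PosDef.dotProduct_mulVec_mul_inv_eq_sq_iff {n : Type*} [Fintype n] [DecidableEq n]
    {A : Matrix n n ℝ} (hA : A.PosDef) {x : n → ℝ} (hx : x ≠ 0) :
    (x ⬝ᵥ (A *ᵥ x)) * (x ⬝ᵥ (A⁻¹ *ᵥ x)) = (x ⬝ᵥ x) ^ 2 ↔ ∃ μ : ℝ, A *ᵥ x = μ • x := by
  have hdet : IsUnit A.det := (isUnit_iff_isUnit_det A).mp hA.isUnit
  have hb : 0 < x ⬝ᵥ (A⁻¹ *ᵥ x) := by simpa using hA.inv.dotProduct_mulVec_pos hx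
  have hAv : A *ᵥ (A⁻¹ *ᵥ x) = x := by
    rw [mulVec_mulVec, mul_nonsing_inv A hdet, one_mulVec]
  constructor
  · intro heq
    generalize A⁻¹ *ᵥ x = v at *
    have hT : Aᵀ = A := by simpa using hA.isHermitian.eq
    have hvx : v ⬝ᵥ (A *ᵥ x) = x ⬝ᵥ x := by
      rw [dotProduct_mulVec, ← mulVec_transpose, hT, hAv]
    set t := (x ⬝ᵥ x) / (x ⬝ᵥ v) with ht
    have hform : (x - t • v) ⬝ᵥ (A *ᵥ (x - t • v)) = 0 := by
      simp only [mulVec_sub, mulVec_smul, hAv, sub_dotProduct, dotProduct_sub, smul_dotProduct,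
        dotProduct_smul, hvx, dotProduct_comm v x, smul_eq_mul]
      rw [ht]
      field_simp
      linear_combination heq
    have hzero : x - t • v = 0 := by
      by_contra hne
      have hpos := hA.dotProduct_mulVec_pos hne
      simp only [star_trivial] at hpos
      exact hpos.ne' hform
    refine ⟨t, ?_⟩
    calc A *ᵥ x = A *ᵥ (t • v) := by rw [← sub_eq_zero.mp hzero]
      _ = t • x := by rw [mulVec_smul, hAv]
  · rintro ⟨μ, hμ⟩
    have hxv : x = μ • (A⁻¹ *ᵥ x) := by
      rw [← mulVec_smul, ← hμ, mulVec_mulVec, nonsing_inv_mul A hdet, one_mulVec]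
    have hxx : x ⬝ᵥ x = μ * (x ⬝ᵥ (A⁻¹ *ᵥ x)) := by
      conv_lhs => rw [hxv, smul_dotProduct, ← hxv, dotProduct_comm, smul_eq_mul]
    rw [hμ, dotProduct_smul, smul_eq_mul]
    linear_combination (-(x ⬝ᵥ x)) * hxx

/-- Equality in Hill's inequality (Reuss = Voigt bulk modulus) holds if and only if
the hydrostatic strain `h` is an eigenvector of the stiffness matrix `C`. -/
theorem reuss_eq_voigt_iff_eigenvector
    (C : Matrix (Fin 3 × Fin 3) (Fin 3 × Fin 3) ℝ) (hC : C.PosDef)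
    (h : (Fin 3 × Fin 3) → ℝ)
    (hh : h = fun p => if p.1 = p.2 then (1 : ℝ) else 0) :
    (h ⬝ᵥ (C⁻¹ *ᵥ h))⁻¹ = (1 / 9) * (h ⬝ᵥ (C *ᵥ h)) ↔ ∃ μ : ℝ, C *ᵥ h = μ • h := by
  have hsq : h ⬝ᵥ h = 3 := by
    simp [hh, dotProduct, Fintype.sum_prod_type]
  have hne : h ≠ 0 := by
    rintro rfl
    simp at hsq
  have hb : 0 < h ⬝ᵥ (C⁻¹ *ᵥ h) := by simpa using hC.inv.dotProduct_mulVec_pos hne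
  rw [← hC.dotProduct_mulVec_mul_inv_eq_sq_iff hne, hsq, inv_eq_one_div,
    div_eq_iff hb.ne']
  constructor <;> intro heq <;> linarith
end

section
/- Let A be an n×n real symmetric positive definite matrix, C an m×m real symmetric positive definite matrix, and B an arbitrary m×n real matrix. Set S = C + B·A⁻¹·Bᵀ, 𝒜̂ = [[A, Bᵀ],[−B, C]], and P_SCP = [[A, 0],[−B, S]]. Then P_SCP is invertible and the right-preconditioned matrix satisfies (𝒜̂·P_SCP⁻¹ − I)² = 0, where I is the (n+m)×(n+m) identity matrix; in particular 𝒜̂·P_SCP⁻¹ − I is nilpotent of order at most 2. -/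
open Matrix

/-- If `T = P * (1 + N)` with `P` invertible and `N ^ 2 = 0`, then `(T * P⁻¹ - 1) ^ 2 = 0`. -/
lemma sq_mul_inv_sub_one_eq_zero {ι R : Type*} [Fintype ι] [DecidableEq ι] [CommRing R]
    {T P N : Matrix ι ι R} (hP : IsUnit P) (hT : T = P * (1 + N)) (hN : N * N = 0) :
    (T * P⁻¹ - 1) ^ 2 = 0 := by
  have hdet : IsUnit P.det := (isUnit_iff_isUnit_det P).mp hP
  have hconj : T * P⁻¹ - 1 = P * N * P⁻¹ := by
    rw [hT, mul_add, mul_one, add_mul, mul_nonsing_inv P hdet, add_sub_cancel_left]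
  calc (T * P⁻¹ - 1) ^ 2 = P * N * (P⁻¹ * P) * N * P⁻¹ := by
        rw [hconj, sq]; simp only [Matrix.mul_assoc]
    _ = P * (N * N) * P⁻¹ := by
        rw [nonsing_inv_mul P hdet, mul_one, Matrix.mul_assoc P N N]
    _ = 0 := by rw [hN, mul_zero, zero_mul]

/-- With the exact Schur complement preconditioner `P_SCP = [[A, 0],[−B, S]]`,
`S = C + B·A⁻¹·Bᵀ`, the right-preconditioned matrix satisfies
`(𝒜̂·P_SCP⁻¹ − I)² = 0`. -/
theorem schurPreconditioned_nilpotent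
    (n m : ℕ) (A : Matrix (Fin n) (Fin n) ℝ) (hA : A.PosDef)
    (C : Matrix (Fin m) (Fin m) ℝ) (hC : C.PosDef)
    (B : Matrix (Fin m) (Fin n) ℝ) :
    IsUnit (Matrix.fromBlocks A 0 (-B) (C + B * A⁻¹ * Bᵀ)) ∧
      (Matrix.fromBlocks A Bᵀ (-B) C *
          (Matrix.fromBlocks A 0 (-B) (C + B * A⁻¹ * Bᵀ))⁻¹ - 1) ^ 2 = 0 := by
  have hS : (C + B * A⁻¹ * Bᵀ).PosDef :=
    hC.add_posSemidef (by
      simpa only [conjTranspose_eq_transpose_of_trivial] using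
        hA.inv.posSemidef.mul_mul_conjTranspose_same B)
  have hP : IsUnit (fromBlocks A 0 (-B) (C + B * A⁻¹ * Bᵀ)) :=
    isUnit_fromBlocks_zero₁₂.mpr ⟨hA.isUnit, hS.isUnit⟩
  have hAA : A * A⁻¹ = 1 := mul_nonsing_inv A ((isUnit_iff_isUnit_det A).mp hA.isUnit)
  refine ⟨hP, sq_mul_inv_sub_one_eq_zero (N := fromBlocks 0 (A⁻¹ * Bᵀ) 0 0) hP ?_ ?_⟩
  · rw [← fromBlocks_one, fromBlocks_add, fromBlocks_multiply]
    simp [← Matrix.mul_assoc, hAA]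
  · simp [fromBlocks_multiply]
end
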